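/- The group G generated by g1, g2, g3 is isomorphic to the semidirect product (Z/5 × Z/5) ⋊ Z/5, where g1, g2 generate a subgroup H ≅ Z/5 × Z/5 normalized by g3, and g3 has order 5. -/

import Mathlib

open Matrix

/-- `ξ = e^{2πi/5}`. -/
noncomputable def ξ : ℂ := Complex.exp (2 * Real.pi * Complex.I / 5)

lemma ξ_ne_zero : ξ ≠ 0 := Complex.exp_ne_zero _

/-- `g₁ = diag(1, ξ, ξ², ξ³, ξ⁴)` as an element of `GL(5, ℂ)`. -/
noncomputable def g1GL : GL (Fin 5) ℂ :=
  Matrix.GeneralLinearGroup.mkOfDetNeZero (Matrix.diagonal fun i => ξ ^ (i : ℕ))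
    (by
      rw [Matrix.det_diagonal]
      exact Finset.prod_ne_zero_iff.mpr fun i _ => pow_ne_zero _ ξ_ne_zero)

/-- `g₂ = diag(1, ξ, ξ³, ξ, 1)` as an element of `GL(5, ℂ)`. -/
noncomputable def g2GL : GL (Fin 5) ℂ :=
  Matrix.GeneralLinearGroup.mkOfDetNeZero (Matrix.diagonal fun i => ξ ^ (![0, 1, 3, 1, 0] i : ℕ))
    (by
      rw [Matrix.det_diagonal]
      exact Finset.prod_ne_zero_iff.mpr fun i _ => pow_ne_zero _ ξ_ne_zero)

/-- `g₃`, the cyclic coordinate shift `(z₀ : ⋯ : z₄) ↦ (z₁ : ⋯ : z₄ : z₀)`, as the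
corresponding permutation matrix in `GL(5, ℂ)`. -/
noncomputable def g3GL : GL (Fin 5) ℂ :=
  Matrix.GeneralLinearGroup.mkOfDetNeZero ((finRotate 5).permMatrix ℂ)
    (by
      rw [Matrix.det_permutation]
      simp)

/-- The projective linear group `PGL(5, ℂ) = GL(5, ℂ)/center`, the automorphism
group of `ℂP⁴`. -/
abbrev PGL5 := GL (Fin 5) ℂ ⧸ Subgroup.center (GL (Fin 5) ℂ)

/-- `g₁` as a projective linear automorphism of `ℂP⁴`. -/
noncomputable def g1 : PGL5 := QuotientGroup.mk g1GL

/-- `g₂` as a projective linear automorphism of `ℂP⁴`. -/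
noncomputable def g2 : PGL5 := QuotientGroup.mk g2GL

/-- `g₃` as a projective linear automorphism of `ℂP⁴`. -/
noncomputable def g3 : PGL5 := QuotientGroup.mk g3GL

/-- The subgroup `H = ⟨g₁, g₂⟩` of the projective automorphisms of `ℂP⁴`. -/
noncomputable def H : Subgroup PGL5 := Subgroup.closure {g1, g2}

/-- The subgroup `G = ⟨g₁, g₂, g₃⟩` of the projective automorphisms of `ℂP⁴`. -/
noncomputable def G : Subgroup PGL5 := Subgroup.closure {g1, g2, g3}

/-- The hom `ℤ/5 → Γ`, `k ↦ a ^ k`, attached to an element with `a ^ 5 = 1`. -/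
def zmodPowHom {Γ : Type*} [Group Γ] (a : Γ) (ha : a ^ 5 = 1) :
    Multiplicative (ZMod 5) →* Γ where
  toFun x := a ^ x.toAdd.val
  map_one' := by simp
  map_mul' x y := by
    rw [toAdd_mul, ZMod.val_add, ← pow_eq_pow_mod _ ha, pow_add]

/-- The hom `(ℤ/5)² → Γ`, `(i, j) ↦ a ^ i * b ^ j`, attached to commuting `a`, `b`. -/
def zmodPowPairHom {Γ : Type*} [Group Γ] (a b : Γ) (ha : a ^ 5 = 1) (hb : b ^ 5 = 1)
    (hab : Commute a b) :
    Multiplicative (ZMod 5) × Multiplicative (ZMod 5) →* Γ :=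
  (zmodPowHom a ha).noncommCoprod (zmodPowHom b hb) fun _ _ => hab.pow_pow _ _

/-- The action of `ℤ/5` on `(ℤ/5)²` by `k • (i, j) = (i + k * j, j)`. -/
def shearHom : Multiplicative (ZMod 5) →*
    MulAut (Multiplicative (ZMod 5) × Multiplicative (ZMod 5)) where
  toFun k :=
    { toFun := fun p => (p.1 * .ofAdd (k.toAdd * p.2.toAdd), p.2)
      invFun := fun p => (p.1 * .ofAdd (-(k.toAdd * p.2.toAdd)), p.2)
      left_inv := fun p => by simp
      right_inv := fun p => by simp
      map_mul' := fun p q => by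
        refine Prod.ext ?_ rfl
        simp only [Prod.fst_mul, Prod.snd_mul, toAdd_mul, mul_add, ofAdd_add]
        exact mul_mul_mul_comm _ _ _ _ }
  map_one' := by ext p <;> simp
  map_mul' k l := by
    refine MulEquiv.ext fun p => Prod.ext ?_ rfl
    simp only [MulAut.mul_apply, MulEquiv.coe_mk, Equiv.coe_fn_mk, toAdd_mul, add_mul, ofAdd_add]
    rw [mul_assoc, mul_comm (Multiplicative.ofAdd (k.toAdd * _))]

section Heisenberg

variable {Γ : Type*} [Group Γ] {a b c : Γ}

lemma pow_mul_eq_of_conj_eq_mul (hab : Commute a b) (hac : Commute a c)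
    (hcb : c * b = a * b * c) (k j : ℕ) : c ^ k * b ^ j = a ^ (k * j) * b ^ j * c ^ k := by
  have h1 : SemiconjBy c b (a * b) := hcb
  have h2 : ∀ k : ℕ, SemiconjBy (c ^ k) b (a ^ k * b) := by
    intro k
    induction k with
    | zero => simp
    | succ k ih =>
      have h3 : SemiconjBy c (a ^ k * b) (a ^ k * (a * b)) :=
        SemiconjBy.mul_right ((hac.pow_left k).symm) h1
      rw [pow_succ', pow_succ, mul_assoc]
      exact h3.mul_left ih
  have h4 := (h2 k).pow_right j
  rw [(hab.pow_left k).mul_pow, ← pow_mul] at h4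
  exact h4

lemma zmodPowPairHom_comp_shearHom (ha : a ^ 5 = 1) (hb : b ^ 5 = 1) (hc : c ^ 5 = 1)
    (hab : Commute a b) (hac : Commute a c) (hcb : c * b = a * b * c)
    (k : Multiplicative (ZMod 5)) :
    (zmodPowPairHom a b ha hb hab).comp (shearHom k).toMonoidHom =
      (MulAut.conj (zmodPowHom c hc k)).toMonoidHom.comp (zmodPowPairHom a b ha hb hab) := by
  refine MonoidHom.ext fun p => ?_
  change a ^ (p.1.toAdd + k.toAdd * p.2.toAdd).val * b ^ p.2.toAdd.val =
    c ^ k.toAdd.val * (a ^ p.1.toAdd.val * b ^ p.2.toAdd.val) * (c ^ k.toAdd.val)⁻¹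
  rw [ZMod.val_add, ← pow_eq_pow_mod _ ha, pow_add, ZMod.val_mul, ← pow_eq_pow_mod _ ha,
    eq_mul_inv_iff_mul_eq, ← mul_assoc (c ^ _), ((hac.pow_pow _ _).eq).symm, mul_assoc (a ^ _) (c ^ _),
    pow_mul_eq_of_conj_eq_mul hab hac hcb]
  simp only [mul_assoc]

/-- The hom from the Heisenberg group `(ℤ/5)² ⋊ ℤ/5` given by `a`, `b`, `c` satisfying its
relations. -/
def heisenbergHom (ha : a ^ 5 = 1) (hb : b ^ 5 = 1) (hc : c ^ 5 = 1)
    (hab : Commute a b) (hac : Commute a c) (hcb : c * b = a * b * c) :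
    (Multiplicative (ZMod 5) × Multiplicative (ZMod 5)) ⋊[shearHom] Multiplicative (ZMod 5) →* Γ :=
  SemidirectProduct.lift (zmodPowPairHom a b ha hb hab) (zmodPowHom c hc)
    (zmodPowPairHom_comp_shearHom ha hb hc hab hac hcb)

lemma zmodPowHom_ofAdd_one (ha : a ^ 5 = 1) : zmodPowHom a ha (.ofAdd 1) = a := pow_one a

lemma zmodPowPairHom_ofAdd_one_left (ha : a ^ 5 = 1) (hb : b ^ 5 = 1) (hab : Commute a b) :
    zmodPowPairHom a b ha hb hab (.ofAdd 1, 1) = a := by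
  change a ^ 1 * b ^ 0 = a
  simp

lemma zmodPowPairHom_ofAdd_one_right (ha : a ^ 5 = 1) (hb : b ^ 5 = 1) (hab : Commute a b) :
    zmodPowPairHom a b ha hb hab (1, .ofAdd 1) = b := by
  change a ^ 0 * b ^ 1 = b
  simp

lemma zmodPowPairHom_range (ha : a ^ 5 = 1) (hb : b ^ 5 = 1) (hab : Commute a b) :
    (zmodPowPairHom a b ha hb hab).range = Subgroup.closure {a, b} := by
  apply le_antisymm
  · rintro _ ⟨p, rfl⟩
    exact mul_mem (pow_mem (Subgroup.subset_closure (by simp)) _)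
      (pow_mem (Subgroup.subset_closure (by simp)) _)
  · rw [Subgroup.closure_le]
    rintro x (rfl | rfl)
    · exact ⟨(.ofAdd 1, 1), zmodPowPairHom_ofAdd_one_left ha hb hab⟩
    · exact ⟨(1, .ofAdd 1), zmodPowPairHom_ofAdd_one_right ha hb hab⟩

lemma heisenbergHom_range (ha : a ^ 5 = 1) (hb : b ^ 5 = 1) (hc : c ^ 5 = 1)
    (hab : Commute a b) (hac : Commute a c) (hcb : c * b = a * b * c) :
    (heisenbergHom ha hb hc hab hac hcb).range = Subgroup.closure {a, b, c} := by
  apply le_antisymm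
  · rintro _ ⟨p, rfl⟩
    exact mul_mem (mul_mem (pow_mem (Subgroup.subset_closure (by simp)) _)
      (pow_mem (Subgroup.subset_closure (by simp)) _))
      (pow_mem (Subgroup.subset_closure (by simp)) _)
  · rw [Subgroup.closure_le]
    rintro x (rfl | rfl | rfl)
    · exact ⟨.inl (.ofAdd 1, 1), by simp [heisenbergHom, zmodPowPairHom_ofAdd_one_left]⟩
    · exact ⟨.inl (1, .ofAdd 1), by simp [heisenbergHom, zmodPowPairHom_ofAdd_one_right]⟩
    · exact ⟨.inr (.ofAdd 1), by simp [heisenbergHom, zmodPowHom_ofAdd_one]⟩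

lemma ofAdd_eq_one_of_five_dvd_val {x : Multiplicative (ZMod 5)} (h : 5 ∣ x.toAdd.val) :
    x = 1 :=
  toAdd_eq_zero.mp <| (ZMod.val_eq_zero _).mp <| Nat.eq_zero_of_dvd_of_lt h (ZMod.val_lt _)

lemma zmodPowPairHom_injective (ha : a ^ 5 = 1) (hb : b ^ 5 = 1) (hab : Commute a b)
    (hind : ∀ i j : ℕ, a ^ i * b ^ j = 1 → 5 ∣ i ∧ 5 ∣ j) :
    Function.Injective (zmodPowPairHom a b ha hb hab) := by
  rw [injective_iff_map_eq_one]
  intro p hp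
  obtain ⟨h1, h2⟩ := hind _ _ hp
  exact Prod.ext (ofAdd_eq_one_of_five_dvd_val h1) (ofAdd_eq_one_of_five_dvd_val h2)

/-- A power of `c` commuting with `b` is trivial, because `c ^ k * b = a ^ k * b * c ^ k`. -/
lemma five_dvd_of_commute_pow (hab : Commute a b) (hac : Commute a c) (hcb : c * b = a * b * c)
    (hind : ∀ i j : ℕ, a ^ i * b ^ j = 1 → 5 ∣ i ∧ 5 ∣ j) {k : ℕ} (h : Commute (c ^ k) b) :
    5 ∣ k := by
  have h1 := pow_mul_eq_of_conj_eq_mul hab hac hcb k 1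
  rw [mul_one, pow_one, h.eq, mul_assoc, right_eq_mul] at h1
  exact (hind k 0 (by simpa using h1)).1

lemma heisenbergHom_injective (ha : a ^ 5 = 1) (hb : b ^ 5 = 1) (hc : c ^ 5 = 1)
    (hab : Commute a b) (hac : Commute a c) (hcb : c * b = a * b * c)
    (hind : ∀ i j : ℕ, a ^ i * b ^ j = 1 → 5 ∣ i ∧ 5 ∣ j) :
    Function.Injective (heisenbergHom ha hb hc hab hac hcb) := by
  rw [injective_iff_map_eq_one]
  intro p hp
  have hp' : a ^ p.left.1.toAdd.val * b ^ p.left.2.toAdd.val * c ^ p.right.toAdd.val = 1 := hp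
  have hcomm : Commute (c ^ p.right.toAdd.val) b := by
    rw [← inv_eq_of_mul_eq_one_right hp']
    exact ((hab.pow_left _).mul_left (Commute.pow_self b _)).inv_left
  have hr := ofAdd_eq_one_of_five_dvd_val (five_dvd_of_commute_pow hab hac hcb hind hcomm)
  rw [hr, toAdd_one, ZMod.val_zero, pow_zero, mul_one] at hp'
  obtain ⟨h1, h2⟩ := hind _ _ hp'
  exact SemidirectProduct.ext
    (Prod.ext (ofAdd_eq_one_of_five_dvd_val h1) (ofAdd_eq_one_of_five_dvd_val h2)) hr

end Heisenberg

lemma ξ_isPrimitiveRoot : IsPrimitiveRoot ξ 5 := by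
  simpa [ξ] using Complex.isPrimitiveRoot_exp 5 (by norm_num)

lemma ξ_pow_five : ξ ^ 5 = 1 := ξ_isPrimitiveRoot.pow_eq_one

lemma coe_g1GL : (g1GL : Matrix (Fin 5) (Fin 5) ℂ) = diagonal fun i : Fin 5 => ξ ^ (i : ℕ) := rfl

lemma coe_g2GL : (g2GL : Matrix (Fin 5) (Fin 5) ℂ) =
    diagonal fun i => ξ ^ (![0, 1, 3, 1, 0] i : ℕ) := rfl

lemma coe_g3GL : (g3GL : Matrix (Fin 5) (Fin 5) ℂ) = (finRotate 5).permMatrix ℂ := rfl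

lemma mk_eq_mk_of_coe_eq_smul {A B : GL (Fin 5) ℂ} (z : ℂ)
    (h : (A : Matrix (Fin 5) (Fin 5) ℂ) = z • (B : Matrix (Fin 5) (Fin 5) ℂ)) :
    (QuotientGroup.mk A : PGL5) = QuotientGroup.mk B := by
  rw [eq_comm, QuotientGroup.eq, Subgroup.mem_center_iff]
  intro g
  have hZ : ((B⁻¹ * A : GL (Fin 5) ℂ) : Matrix (Fin 5) (Fin 5) ℂ) = z • 1 := by
    rw [Units.val_mul, h, mul_smul_comm, Units.inv_mul]
  ext1
  rw [Units.val_mul g, Units.val_mul _ g, hZ]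
  simp

lemma g1_pow_five : g1 ^ 5 = 1 := by
  have h : g1GL ^ 5 = 1 := by
    ext1
    rw [Units.val_pow_eq_pow_val, coe_g1GL, diagonal_pow, Units.val_one, ← diagonal_one]
    congr 1
    ext i
    simp [← pow_mul, mul_comm _ 5, pow_mul ξ 5, ξ_pow_five]
  exact congrArg (QuotientGroup.mk (s := Subgroup.center (GL (Fin 5) ℂ))) h

lemma g2_pow_five : g2 ^ 5 = 1 := by
  have h : g2GL ^ 5 = 1 := by
    ext1
    rw [Units.val_pow_eq_pow_val, coe_g2GL, diagonal_pow, Units.val_one, ← diagonal_one]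
    congr 1
    ext i
    simp [← pow_mul, mul_comm _ 5, pow_mul ξ 5, ξ_pow_five]
  exact congrArg (QuotientGroup.mk (s := Subgroup.center (GL (Fin 5) ℂ))) h

lemma g3_pow_five : g3 ^ 5 = 1 := by
  have h : g3GL ^ 5 = 1 := by
    ext1
    rw [Units.val_pow_eq_pow_val, coe_g3GL, Units.val_one, ← permMatrix_one,
      show (1 : Equiv.Perm (Fin 5)) = finRotate 5 * (finRotate 5 * (finRotate 5 *
        (finRotate 5 * finRotate 5))) by decide]
    simp only [permMatrix_mul, pow_succ, pow_zero, one_mul]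
  exact congrArg (QuotientGroup.mk (s := Subgroup.center (GL (Fin 5) ℂ))) h

lemma commute_g1_g2 : Commute g1 g2 := by
  have h : g1GL * g2GL = g2GL * g1GL := by
    ext1
    rw [Units.val_mul, Units.val_mul, coe_g1GL, coe_g2GL, diagonal_mul_diagonal,
      diagonal_mul_diagonal]
    simp only [mul_comm]
  exact congrArg (QuotientGroup.mk (s := Subgroup.center (GL (Fin 5) ℂ))) h

lemma commute_g1_g3 : Commute g1 g3 := by
  refine (mk_eq_mk_of_coe_eq_smul (A := g3GL * g1GL) (B := g1GL * g3GL) ξ ?_).symm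
  rw [Units.val_mul, Units.val_mul, coe_g1GL, coe_g3GL]
  ext i j
  have := ξ_pow_five
  fin_cases i <;> fin_cases j <;>
    simp [Equiv.Perm.permMatrix, PEquiv.toMatrix_apply, finRotate_apply] <;> grind

lemma g3_mul_g2 : g3 * g2 = g1 * g2 * g3 := by
  refine mk_eq_mk_of_coe_eq_smul (A := g3GL * g2GL) (B := g1GL * g2GL * g3GL) ξ ?_
  rw [Units.val_mul, Units.val_mul, Units.val_mul, coe_g1GL, coe_g2GL, coe_g3GL,
    diagonal_mul_diagonal]
  ext i j
  have := ξ_pow_five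
  fin_cases i <;> fin_cases j <;>
    simp [Equiv.Perm.permMatrix, PEquiv.toMatrix_apply, finRotate_apply] <;> grind

lemma five_dvd_of_g1_pow_mul_g2_pow_eq_one (i j : ℕ) (h : g1 ^ i * g2 ^ j = 1) :
    5 ∣ i ∧ 5 ∣ j := by
  have hmem : g1GL ^ i * g2GL ^ j ∈ Subgroup.center (GL (Fin 5) ℂ) :=
    (QuotientGroup.eq_one_iff _).mp h
  have hcomm := congrArg Units.val (Subgroup.mem_center_iff.mp hmem g3GL)
  simp only [Units.val_mul, Units.val_pow_eq_pow_val, coe_g1GL, coe_g2GL, coe_g3GL, diagonal_pow,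
    diagonal_mul_diagonal] at hcomm
  have h0 := congrFun (congrFun hcomm 0) 1
  have h4 := congrFun (congrFun hcomm 4) 0
  simp [Equiv.Perm.permMatrix, PEquiv.toMatrix_apply, finRotate_apply, ← pow_add,
    ← pow_mul] at h0 h4
  have hi := (ξ_isPrimitiveRoot.pow_eq_one_iff_dvd _).mp h0
  have hj := (ξ_isPrimitiveRoot.pow_eq_one_iff_dvd _).mp h4.symm
  omega

lemma orderOf_g3 : orderOf g3 = 5 := by
  have : Fact (Nat.Prime 5) := ⟨Nat.prime_five⟩
  refine orderOf_eq_prime g3_pow_five fun h => ?_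
  have := five_dvd_of_commute_pow commute_g1_g2 commute_g1_g3 g3_mul_g2
    five_dvd_of_g1_pow_mul_g2_pow_eq_one (k := 1) (by simp [h])
  omega

lemma g3_conj_mem_H {h : PGL5} (hh : h ∈ H) : g3 * h * g3⁻¹ ∈ H := by
  have hle : H ≤ H.comap (MulAut.conj g3).toMonoidHom := by
    conv_lhs => rw [H]
    rw [Subgroup.closure_le]
    have h1 : g1 ∈ H := Subgroup.subset_closure (by simp)
    have h2 : g2 ∈ H := Subgroup.subset_closure (by simp)
    rintro x (rfl | rfl)
    · change g3 * g1 * g3⁻¹ ∈ H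
      rwa [← commute_g1_g3.eq, mul_inv_cancel_right]
    · change g3 * g2 * g3⁻¹ ∈ H
      rw [g3_mul_g2, mul_inv_cancel_right]
      exact mul_mem h1 h2
  exact hle hh

/-- The group `G = ⟨g₁, g₂, g₃⟩` is isomorphic to the semidirect product
`(ℤ/5 × ℤ/5) ⋊ ℤ/5`, where `H = ⟨g₁, g₂⟩ ≅ ℤ/5 × ℤ/5` is normalized by `g₃`, and
`g₃` has order 5. -/
theorem G_iso_semidirect :
    Nonempty (H ≃* Multiplicative (ZMod 5) × Multiplicative (ZMod 5)) ∧
    (∀ h ∈ H, g3 * h * g3⁻¹ ∈ H) ∧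
    orderOf g3 = 5 ∧
    ∃ φ : Multiplicative (ZMod 5) →*
        MulAut (Multiplicative (ZMod 5) × Multiplicative (ZMod 5)),
      Nonempty (G ≃*
        (Multiplicative (ZMod 5) × Multiplicative (ZMod 5)) ⋊[φ] Multiplicative (ZMod 5)) := by
  have hH := zmodPowPairHom_range g1_pow_five g2_pow_five commute_g1_g2
  have hG := heisenbergHom_range g1_pow_five g2_pow_five g3_pow_five commute_g1_g2
    commute_g1_g3 g3_mul_g2
  refine ⟨⟨((MonoidHom.ofInjective (zmodPowPairHom_injective g1_pow_five g2_pow_five commute_g1_g2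
      five_dvd_of_g1_pow_mul_g2_pow_eq_one)).trans (MulEquiv.subgroupCongr hH)).symm⟩,
    fun h hh => g3_conj_mem_H hh, orderOf_g3, shearHom,
    ⟨((MonoidHom.ofInjective (heisenbergHom_injective g1_pow_five g2_pow_five g3_pow_five
      commute_g1_g2 commute_g1_g3 g3_mul_g2
      five_dvd_of_g1_pow_mul_g2_pow_eq_one)).trans (MulEquiv.subgroupCongr hG)).symm⟩⟩
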